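/- Let G be a finite abelian group, L/F a finite Galois field extension, and σ̄: G → Gal(L/F) a surjective group homomorphism with kernel K. For a group homomorphism f: K → H¹(G,L^×) and a 2-cocycle τ ∈ Z²(K,L^×) (trivial K-action on L^×), the equation δ(f) = π_*([τ]) holds in H²(K,L^×/F^×) if and only if there exist 1-cocycles f_k ∈ Z¹(G,L^×), for all k ∈ K, such that f(k) = [f_k] and f_{k1}·f_{k2} = d(τ(k1,k2))·f_{k1k2} for all k1,k2 ∈ K. -/

import Mathlib

/-!
# Statement 10

Let `G` be a finite abelian group, `L/F` a finite Galois field extension and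
`σ̄ : G → Gal(L/F)` a surjective homomorphism with kernel `K`.  For a group homomorphism
`f : K → H¹(G,L^×)` and a 2-cocycle `τ ∈ Z²(K,L^×)` (trivial `K`-action on `L^×`), the
equation `δ(f) = π_*([τ])` holds in `H²(K, L^×/F^×)` if and only if there exist 1-cocycles
`f_k ∈ Z¹(G,L^×)` with `f(k) = [f_k]` and `f_{k₁}·f_{k₂} = d(τ(k₁,k₂))·f_{k₁k₂}` for all
`k₁, k₂ ∈ K`.

Implementation notes.  `Z¹`, `B¹` are subgroups of the group of maps `G → L^×` and
`H¹ = Z¹/B¹`.  The equation `δ(f) = π_*([τ])` is expressed in the quotient of the group of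
all maps `K × K → L^×/F^×` by the subgroup of 2-coboundaries (equality of classes of
2-cocycles there is equivalent to equality in `H²(K, L^×/F^×)`).  `δ` is computed from chosen
representatives (`Quotient.out`) of the classes `f(k)`: the resulting 2-cocycle with values in
`B¹(G,L^×)` is composed with the isomorphism `B¹(G,L^×) ≅ L^×/F^×`, `dl ↦ l·F^×`, and
`π_*([τ])` is the class of `π ∘ τ`.
-/

section Coh

variable (F : Type) {L : Type} [Field F] [Field L] [Algebra F L]
variable {G : Type} [CommGroup G]
variable (θ : G →* (L ≃ₐ[F] L))

/-- The action of `G` on `L^×` induced by `θ`. -/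
def uact (g : G) : Lˣ →* Lˣ := Units.map ((θ g).toAlgHom.toRingHom.toMonoidHom)

/-- The group `Z¹(G, L^×)` of 1-cocycles. -/
def Z1 : Subgroup (G → Lˣ) where
  carrier := {u | ∀ g1 g2, u (g1 * g2) = u g1 * uact F θ g1 (u g2)}
  one_mem' := by intro g1 g2; simp
  mul_mem' := by
    intro a b ha hb g1 g2
    show a (g1 * g2) * b (g1 * g2) = (a g1 * b g1) * uact F θ g1 (a g2 * b g2)
    rw [ha, hb, map_mul, mul_mul_mul_comm]
  inv_mem' := by
    intro a ha g1 g2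
    show (a (g1 * g2))⁻¹ = (a g1)⁻¹ * uact F θ g1 (a g2)⁻¹
    rw [ha, map_inv, mul_inv]

/-- The group `B¹(G, L^×)` of 1-coboundaries `dl : g ↦ σ̄_g(l)·l⁻¹`. -/
def B1 : Subgroup (G → Lˣ) where
  carrier := {u | ∃ l : Lˣ, ∀ g, u g = uact F θ g l * l⁻¹}
  one_mem' := ⟨1, by simp⟩
  mul_mem' := by
    rintro a b ⟨l, hl⟩ ⟨m, hm⟩
    refine ⟨l * m, fun g => ?_⟩
    show a g * b g = uact F θ g (l * m) * (l * m)⁻¹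
    rw [hl, hm, map_mul, mul_inv, mul_mul_mul_comm]
  inv_mem' := by
    rintro a ⟨l, hl⟩
    refine ⟨l⁻¹, fun g => ?_⟩
    show (a g)⁻¹ = uact F θ g l⁻¹ * l⁻¹⁻¹
    rw [hl g, map_inv, mul_inv, inv_inv]

/-- `H¹(G, L^×) = Z¹(G, L^×)/B¹(G, L^×)`. -/
def H1 := ↥(Z1 F θ) ⧸ Subgroup.subgroupOf (B1 F θ) (Z1 F θ)

noncomputable instance : CommGroup (H1 F θ) := by unfold H1; infer_instance

/-- The embedding `F^× → L^×`. -/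
def FtoL : Fˣ →* Lˣ := Units.map (algebraMap F L).toMonoidHom

end Coh

/-- `L^×/F^×`. -/
def LmodF (F L : Type) [Field F] [Field L] [Algebra F L] : Type :=
  Lˣ ⧸ (FtoL F (L := L)).range

noncomputable instance (F L : Type) [Field F] [Field L] [Algebra F L] :
    CommGroup (LmodF F L) := by unfold LmodF; infer_instance

section Coh

variable (F : Type) {L : Type} [Field F] [Field L] [Algebra F L]
variable {G : Type} [CommGroup G]
variable (θ : G →* (L ≃ₐ[F] L))

/-- 2-coboundaries: the subgroup `B²(K, M)` of the group of all maps
`K × K → M` (trivial action). -/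
def B2 (K : Type) [CommGroup K] (M : Type) [CommGroup M] : Subgroup (K → K → M) where
  carrier := {t | ∃ ρ : K → M, ∀ k1 k2, t k1 k2 = ρ k1 * ρ k2 * (ρ (k1 * k2))⁻¹}
  one_mem' := ⟨1, by simp⟩
  mul_mem' := by
    rintro a b ⟨ρ, hρ⟩ ⟨π, hπ⟩
    refine ⟨ρ * π, fun k1 k2 => ?_⟩
    show a k1 k2 * b k1 k2 = (ρ k1 * π k1) * (ρ k2 * π k2) * ((ρ (k1 * k2) * π (k1 * k2)))⁻¹
    rw [hρ, hπ, mul_inv]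
    ac_rfl
  inv_mem' := by
    rintro a ⟨ρ, hρ⟩
    refine ⟨ρ⁻¹, fun k1 k2 => ?_⟩
    show (a k1 k2)⁻¹ = (ρ k1)⁻¹ * (ρ k2)⁻¹ * ((ρ (k1 * k2))⁻¹)⁻¹
    rw [hρ, mul_inv, mul_inv, inv_inv]

/-- The ambient quotient (all maps `K × K → L^×/F^×` modulo 2-coboundaries) in which the
equation `δ(f) = π_*([τ])` is stated; on classes of 2-cocycles it restricts to
`H²(K, L^×/F^×)`. -/
def Q2 := (↥(MonoidHom.ker θ) → ↥(MonoidHom.ker θ) → LmodF F L) ⧸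
  B2 ↥(MonoidHom.ker θ) (LmodF F L)

open Classical in
/-- The isomorphism `B¹(G,L^×) → L^×/F^×`, `dl ↦ l·F^×` (extended by `1`). -/
noncomputable def etaB1 (u : G → Lˣ) : LmodF F L :=
  if h : ∃ l : Lˣ, ∀ g, u g = uact F θ g l * l⁻¹ then QuotientGroup.mk h.choose else 1

/-- The `B¹(G,L^×)`-valued 2-cocycle `γ(k₁,k₂) = f_{k₁} f_{k₂} f_{k₁k₂}⁻¹` obtained from
chosen representatives of the classes `f(k) ∈ H¹(G,L^×)`. -/
noncomputable def gammaOf (f : ↥(MonoidHom.ker θ) → H1 F θ)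
    (k1 k2 : ↥(MonoidHom.ker θ)) : ↥(Z1 F θ) :=
  Quotient.out (f k1) * Quotient.out (f k2) * (Quotient.out (f (k1 * k2)))⁻¹

/-- `δ(f)`, the connecting map `Hom(K, H¹(G,L^×)) → H²(K, L^×/F^×)`, computed in `Q2`. -/
noncomputable def deltaQ (f : ↥(MonoidHom.ker θ) → H1 F θ) : Q2 F θ :=
  QuotientGroup.mk (fun k1 k2 => etaB1 F θ ((gammaOf F θ f k1 k2 : G → Lˣ)))

/-- `π_*([τ])`, the class of `π ∘ τ`, computed in `Q2`. -/
noncomputable def piStarQ (τ : ↥(MonoidHom.ker θ) → ↥(MonoidHom.ker θ) → Lˣ) : Q2 F θ :=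
  QuotientGroup.mk (fun k1 k2 => (QuotientGroup.mk (τ k1 k2) : LmodF F L))

/-- The 2-cocycle condition (trivial action). -/
def IsTwoCocycle {K : Type} [CommGroup K] (τ : K → K → Lˣ) : Prop :=
  ∀ k1 k2 k3, τ k1 k2 * τ (k1 * k2) k3 = τ k2 k3 * τ k1 (k2 * k3)

end Coh

section Coboundary

variable (F : Type) {L : Type} [Field F] [Field L] [Algebra F L]
variable {G : Type} [CommGroup G]
variable (θ : G →* (L ≃ₐ[F] L))

/-- The coboundary homomorphism `l ↦ dl`, where `dl g = σ̄_g(l)·l⁻¹`. -/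
def coboundaryHom : Lˣ →* (G → Lˣ) where
  toFun l g := uact F θ g l * l⁻¹
  map_one' := by ext g; simp
  map_mul' a b := by
    funext g
    simp only [map_mul, mul_inv, Pi.mul_apply]
    exact mul_mul_mul_comm _ _ _ _

theorem coboundaryHom_apply (l : Lˣ) (g : G) :
    coboundaryHom F θ l g = uact F θ g l * l⁻¹ := rfl

theorem mem_B1_iff (u : G → Lˣ) : u ∈ B1 F θ ↔ ∃ l, u = coboundaryHom F θ l :=
  exists_congr fun _ => funext_iff.symm

theorem coboundaryHom_mem_Z1 (l : Lˣ) : coboundaryHom F θ l ∈ Z1 F θ := by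
  intro g₁ g₂
  have h : uact F θ (g₁ * g₂) l = uact F θ g₁ (uact F θ g₂ l) := by
    ext
    simp [uact]
  rw [coboundaryHom_apply, coboundaryHom_apply, coboundaryHom_apply, h, map_mul, map_inv,
    mul_comm (_ * l⁻¹), ← mul_assoc, inv_mul_cancel_right]

/-- The projection `L^× → L^×/F^×`. -/
def projLmodF : Lˣ →* LmodF F L where
  toFun l := QuotientGroup.mk l
  map_one' := rfl
  map_mul' _ _ := rfl

theorem projLmodF_surjective : Function.Surjective (projLmodF F (L := L)) :=
  QuotientGroup.mk_surjective

theorem projLmodF_eq_one_iff (l : Lˣ) :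
    projLmodF F l = 1 ↔ l ∈ (FtoL F (L := L)).range :=
  QuotientGroup.eq_one_iff l

variable {θ}

theorem coboundaryHom_eq_one_iff [FiniteDimensional F L] [IsGalois F L]
    (hsurj : Function.Surjective θ) (l : Lˣ) :
    coboundaryHom F θ l = 1 ↔ projLmodF F l = 1 := by
  rw [projLmodF_eq_one_iff]
  constructor
  · intro h
    have hfix : ∀ σ : L ≃ₐ[F] L, σ (l : L) = l := by
      intro σ
      obtain ⟨g, rfl⟩ := hsurj σ
      have hg := mul_inv_eq_one.mp (congrFun h g)
      exact congrArg Units.val hg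
    obtain ⟨a, ha⟩ := (IsGalois.mem_range_algebraMap_iff_fixed (F := F) (l : L)).mpr hfix
    have ha0 : a ≠ 0 := by
      rintro rfl
      exact l.ne_zero (by rw [← ha, map_zero])
    exact ⟨Units.mk0 a ha0, Units.ext ha⟩
  · rintro ⟨a, rfl⟩
    funext g
    refine mul_inv_eq_one.mpr (Units.ext ?_)
    exact (θ g).commutes (a : F)

theorem coboundaryHom_eq_iff [FiniteDimensional F L] [IsGalois F L]
    (hsurj : Function.Surjective θ) (l m : Lˣ) :
    coboundaryHom F θ l = coboundaryHom F θ m ↔ projLmodF F l = projLmodF F m := by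
  rw [← div_eq_one, ← map_div, coboundaryHom_eq_one_iff F hsurj, map_div, div_eq_one]

theorem etaB1_coboundaryHom [FiniteDimensional F L] [IsGalois F L]
    (hsurj : Function.Surjective θ) (l : Lˣ) :
    etaB1 F θ (coboundaryHom F θ l) = projLmodF F l := by
  have h : ∃ m : Lˣ, ∀ g, coboundaryHom F θ l g = uact F θ g m * m⁻¹ := ⟨l, fun _ => rfl⟩
  exact (dif_pos h).trans
    ((coboundaryHom_eq_iff F hsurj l h.choose).mp (funext h.choose_spec)).symm

variable (θ)

/-- The projection `Z¹(G, L^×) → H¹(G, L^×)`. -/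
def projH1 : ↥(Z1 F θ) →* H1 F θ where
  toFun u := QuotientGroup.mk u
  map_one' := rfl
  map_mul' _ _ := rfl

/-- The chosen representative of a class in `H¹(G, L^×)`. -/
noncomputable def repH1 (x : H1 F θ) : ↥(Z1 F θ) := Quotient.out x

theorem projH1_repH1 (x : H1 F θ) : projH1 F θ (repH1 F θ x) = x :=
  Quotient.out_eq x

theorem gammaOf_eq (f : ↥(MonoidHom.ker θ) → H1 F θ) (k₁ k₂ : ↥(MonoidHom.ker θ)) :
    gammaOf F θ f k₁ k₂ =
      repH1 F θ (f k₁) * repH1 F θ (f k₂) * (repH1 F θ (f (k₁ * k₂)))⁻¹ := rfl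

theorem projH1_eq_one_iff (u : ↥(Z1 F θ)) :
    projH1 F θ u = 1 ↔ ∃ l, (u : G → Lˣ) = coboundaryHom F θ l :=
  (QuotientGroup.eq_one_iff u).trans (Subgroup.mem_subgroupOf.trans (mem_B1_iff F θ u))

theorem projH1_eq_iff (u v : ↥(Z1 F θ)) :
    projH1 F θ u = projH1 F θ v ↔ ∃ l, (u : G → Lˣ) = v * coboundaryHom F θ l := by
  rw [← div_eq_one, ← map_div, projH1_eq_one_iff]
  refine exists_congr fun l => ?_
  rw [Subgroup.coe_div, div_eq_iff_eq_mul']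

theorem exists_gammaOf_eq (f : ↥(MonoidHom.ker θ) →* H1 F θ) (k₁ k₂ : ↥(MonoidHom.ker θ)) :
    ∃ l, (gammaOf F θ (fun k => f k) k₁ k₂ : G → Lˣ) = coboundaryHom F θ l := by
  rw [← projH1_eq_one_iff, gammaOf_eq, map_mul, map_mul, map_inv, projH1_repH1, projH1_repH1,
    projH1_repH1, map_mul, mul_inv_cancel]

theorem deltaQ_eq_piStarQ_iff (f : ↥(MonoidHom.ker θ) → H1 F θ)
    (τ : ↥(MonoidHom.ker θ) → ↥(MonoidHom.ker θ) → Lˣ) :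
    deltaQ F θ f = piStarQ F θ τ ↔ ∃ m : ↥(MonoidHom.ker θ) → Lˣ, ∀ k₁ k₂,
      projLmodF F (τ k₁ k₂) =
        etaB1 F θ (gammaOf F θ f k₁ k₂) * projLmodF F (m k₁ * m k₂ * (m (k₁ * k₂))⁻¹) := by
  have key : deltaQ F θ f = piStarQ F θ τ ↔ ∃ ρ : ↥(MonoidHom.ker θ) → LmodF F L, ∀ k₁ k₂,
      (etaB1 F θ (gammaOf F θ f k₁ k₂))⁻¹ * projLmodF F (τ k₁ k₂) =
        ρ k₁ * ρ k₂ * (ρ (k₁ * k₂))⁻¹ := QuotientGroup.eq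
  rw [key, ((projLmodF_surjective F (L := L)).comp_left).exists]
  simp only [Function.comp_apply, map_mul, map_inv, inv_mul_eq_iff_eq_mul]

end Coboundary

/-- **Statement 10.**  For a group homomorphism `f : K → H¹(G,L^×)` and a 2-cocycle
`τ ∈ Z²(K,L^×)`, one has `δ(f) = π_*([τ])` iff there are 1-cocycles `f_k ∈ Z¹(G,L^×)` with
`f(k) = [f_k]` and `f_{k₁}·f_{k₂} = d(τ(k₁,k₂))·f_{k₁k₂}`. -/
theorem statement10
    {F L : Type} [Field F] [Field L] [Algebra F L]
    [FiniteDimensional F L] [IsGalois F L]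
    {G : Type} [CommGroup G] [Finite G]
    (θ : G →* (L ≃ₐ[F] L)) (hsurj : Function.Surjective θ)
    (f : ↥(MonoidHom.ker θ) →* H1 F θ)
    (τ : ↥(MonoidHom.ker θ) → ↥(MonoidHom.ker θ) → Lˣ)
    (hτ : IsTwoCocycle τ) :
    deltaQ F θ (fun k => f k) = piStarQ F θ τ ↔
      ∃ r : ↥(MonoidHom.ker θ) → ↥(Z1 F θ),
        (∀ k, (QuotientGroup.mk (r k) : H1 F θ) = f k) ∧
        (∀ (k1 k2 : ↥(MonoidHom.ker θ)) (g : G),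
          ((r k1 : G → Lˣ)) g * ((r k2 : G → Lˣ)) g =
            (uact F θ g (τ k1 k2) * (τ k1 k2)⁻¹) * ((r (k1 * k2) : G → Lˣ)) g) := by
  rw [deltaQ_eq_piStarQ_iff]
  choose l hl using exists_gammaOf_eq F θ f
  have hout : ∀ k₁ k₂, (repH1 F θ (f k₁) : G → Lˣ) * repH1 F θ (f k₂) =
      coboundaryHom F θ (l k₁ k₂) * repH1 F θ (f (k₁ * k₂)) := by
    intro k₁ k₂
    rw [← hl]
    simp [gammaOf_eq]
  have heq : ∀ (m : ↥(MonoidHom.ker θ) → Lˣ) (r : ↥(MonoidHom.ker θ) → ↥(Z1 F θ)),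
      (∀ k, (r k : G → Lˣ) = repH1 F θ (f k) * coboundaryHom F θ (m k)) →
      ∀ k₁ k₂, projLmodF F (τ k₁ k₂) =
          etaB1 F θ (gammaOf F θ (fun k => f k) k₁ k₂) *
            projLmodF F (m k₁ * m k₂ * (m (k₁ * k₂))⁻¹) ↔
        (r k₁ : G → Lˣ) * r k₂ = coboundaryHom F θ (τ k₁ k₂) * r (k₁ * k₂) := by
    intro m r hr k₁ k₂
    rw [hl, etaB1_coboundaryHom F hsurj, ← map_mul, ← coboundaryHom_eq_iff F hsurj, hr, hr, hr,
      mul_mul_mul_comm, hout]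
    generalize (repH1 F θ (f (k₁ * k₂)) : G → Lˣ) = x
    simp only [map_mul, map_inv]
    generalize coboundaryHom F θ (τ k₁ k₂) = t
    generalize coboundaryHom F θ (l k₁ k₂) = a
    generalize coboundaryHom F θ (m k₁) * coboundaryHom F θ (m k₂) = b
    generalize coboundaryHom F θ (m (k₁ * k₂)) = c
    rw [← mul_assoc a, eq_mul_inv_iff_mul_eq, mul_right_comm a x b, ← mul_assoc t,
      mul_right_comm t x c, mul_left_inj]
    exact eq_comm
  constructor
  · rintro ⟨m, hm⟩
    let r : ↥(MonoidHom.ker θ) → ↥(Z1 F θ) := fun k =>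
      repH1 F θ (f k) * ⟨coboundaryHom F θ (m k), coboundaryHom_mem_Z1 F θ (m k)⟩
    have hr : ∀ k, (r k : G → Lˣ) = repH1 F θ (f k) * coboundaryHom F θ (m k) :=
      fun _ => rfl
    refine ⟨r, fun k => ?_, fun k₁ k₂ g => congrFun ((heq m r hr k₁ k₂).mp (hm k₁ k₂)) g⟩
    exact ((projH1_eq_iff F θ (r k) _).mpr ⟨m k, hr k⟩).trans (projH1_repH1 F θ (f k))
  · rintro ⟨r, hr, hmul⟩
    have h : ∀ k, ∃ a, (r k : G → Lˣ) = repH1 F θ (f k) * coboundaryHom F θ a := fun k =>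
      (projH1_eq_iff F θ (r k) _).mp ((hr k).trans (projH1_repH1 F θ (f k)).symm)
    choose m hm using h
    exact ⟨m, fun k₁ k₂ => (heq m r hm k₁ k₂).mpr (funext (hmul k₁ k₂))⟩
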